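/- arXiv:2008.01005 — 2 statements merged into one kernel-verified Lean document; each statement's English description precedes it below -/
import Mathlib

section
/- Let n ≥ 1 be an integer, let u ∈ ℝⁿ, and let x, y ∈ ℝ² \ {0} satisfy |x| ≥ |u| and |y| ≥ |u|. Then |(x,u)/|(x,u)| − (y,u)/|(y,u)|| ≥ (1/4)·|x/|x| − y/|y||, where (x,u) denotes the vector in ℝ^{2+n} whose first two coordinates are those of x and whose last n coordinates are those of u, and |·| denotes the Euclidean norm. -/
noncomputable section

/-- The concatenation `(x,u) ∈ ℝ^{2+n}` of `x ∈ ℝ²` and `u ∈ ℝⁿ` (Euclidean norm,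
so `|(x,u)|² = |x|² + |u|²`). -/
def concatVec {n : ℕ} (x : EuclideanSpace ℝ (Fin 2)) (u : EuclideanSpace ℝ (Fin n)) :
    EuclideanSpace ℝ (Fin (2 + n)) :=
  (WithLp.equiv 2 (Fin (2 + n) → ℝ)).symm
    (Fin.append (WithLp.equiv 2 (Fin 2 → ℝ) x) (WithLp.equiv 2 (Fin n → ℝ) u))

theorem le_of_sq_le_sq_aux {a b : ℝ} (h : a ^ 2 ≤ b ^ 2) (hb : 0 ≤ b) : a ≤ b :=
  abs_le_of_sq_le_sq' h hb |>.2

theorem concatVec_inner {n : ℕ} (x y : EuclideanSpace ℝ (Fin 2))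
    (u : EuclideanSpace ℝ (Fin n)) :
    inner ℝ (concatVec x u) (concatVec y u) = inner ℝ x y + ‖u‖ ^ 2 := by
  rw [← real_inner_self_eq_norm_sq u]
  simp only [PiLp.inner_apply, concatVec]
  rw [Fin.sum_univ_add]
  simp

theorem unit_sub_sq {E : Type*} [NormedAddCommGroup E] [InnerProductSpace ℝ E] (v w : E)
    (hv : 0 < ‖v‖) (hw : 0 < ‖w‖) :
    ‖‖v‖⁻¹ • v - ‖w‖⁻¹ • w‖ ^ 2 = 2 * (‖v‖ * ‖w‖ - inner ℝ v w) / (‖v‖ * ‖w‖) := by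
  rw [norm_sub_sq_real, norm_smul, norm_smul, real_inner_smul_left, real_inner_smul_right]
  simp only [norm_inv, norm_norm]
  field_simp
  ring

/-- **Lemma 5.1 (angular separation under concatenation).** -/
theorem angular_separation_concat
    (n : ℕ) (hn : 1 ≤ n) (u : EuclideanSpace ℝ (Fin n))
    (x y : EuclideanSpace ℝ (Fin 2)) (hx : x ≠ 0) (hy : y ≠ 0)
    (hxu : ‖u‖ ≤ ‖x‖) (hyu : ‖u‖ ≤ ‖y‖) :
    (1 / 4) * ‖‖x‖⁻¹ • x - ‖y‖⁻¹ • y‖ ≤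
      ‖‖concatVec x u‖⁻¹ • concatVec x u - ‖concatVec y u‖⁻¹ • concatVec y u‖ := by
  have hX : 0 < ‖x‖ := norm_pos_iff.mpr hx
  have hY : 0 < ‖y‖ := norm_pos_iff.mpr hy
  have hU : 0 ≤ ‖u‖ := norm_nonneg u
  have hA2 : ‖concatVec x u‖ ^ 2 = ‖x‖ ^ 2 + ‖u‖ ^ 2 := by
    rw [← real_inner_self_eq_norm_sq, concatVec_inner, real_inner_self_eq_norm_sq]
  have hB2 : ‖concatVec y u‖ ^ 2 = ‖y‖ ^ 2 + ‖u‖ ^ 2 := by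
    rw [← real_inner_self_eq_norm_sq, concatVec_inner, real_inner_self_eq_norm_sq]
  have hA : 0 < ‖concatVec x u‖ := by
    refine lt_of_le_of_ne (norm_nonneg _) fun h => ?_
    rw [← h] at hA2
    nlinarith
  have hB : 0 < ‖concatVec y u‖ := by
    refine lt_of_le_of_ne (norm_nonneg _) fun h => ?_
    rw [← h] at hB2
    nlinarith
  have hp : inner ℝ x y ≤ ‖x‖ * ‖y‖ := real_inner_le_norm x y
  have e1 := unit_sub_sq x y hX hY
  have e2 := unit_sub_sq (concatVec x u) (concatVec y u) hA hB
  rw [concatVec_inner] at e2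
  refine le_of_sq_le_sq_aux ?_ (norm_nonneg _)
  rw [mul_pow, e1, e2]
  generalize ‖concatVec x u‖ = A at *
  generalize ‖concatVec y u‖ = B at *
  generalize inner ℝ x y = p at *
  generalize ‖x‖ = X at *
  generalize ‖y‖ = Y at *
  generalize ‖u‖ = U at *
  have hAB : 0 < A * B := mul_pos hA hB
  have hXY : 0 < X * Y := mul_pos hX hY
  have hsq : (A * B) ^ 2 = (X ^ 2 + U ^ 2) * (Y ^ 2 + U ^ 2) := by rw [mul_pow, hA2, hB2]
  have h1 : X * Y + U ^ 2 ≤ A * B := by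
    refine le_of_sq_le_sq_aux ?_ hAB.le
    rw [hsq]
    nlinarith [mul_nonneg (sq_nonneg U) (sq_nonneg (X - Y))]
  have h2 : A * B ≤ 2 * (X * Y) := by
    refine le_of_sq_le_sq_aux ?_ (by positivity)
    rw [hsq]
    have a1 : X ^ 2 + U ^ 2 ≤ 2 * X ^ 2 := by nlinarith
    have a2 : Y ^ 2 + U ^ 2 ≤ 2 * Y ^ 2 := by nlinarith
    calc _ ≤ (2 * X ^ 2) * (2 * Y ^ 2) := by gcongr
      _ = _ := by ring
  have h3 : 2 * (X * Y - p) / (A * B) ≤ 2 * (A * B - (p + U ^ 2)) / (A * B) := by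
    apply div_le_div_of_nonneg_right _ hAB.le
    linarith
  refine le_trans ?_ h3
  rw [mul_div_assoc', div_le_div_iff₀ hXY hAB]
  nlinarith [mul_le_mul_of_nonneg_left h2 (sub_nonneg.mpr hp), mul_nonneg (sub_nonneg.mpr hp) hXY.le]
end
end

section
/- Let d ≥ 2 and N ≥ 1 be integers, and for each k ∈ {1,…,N} let Λ_k ⊂ 𝕊^{d-1} be a set such that every point of 𝕊^{d-1} lies within Euclidean distance 2^{-k} of some element of Λ_k. Then for every pair of points ξ, ξ′ ∈ Σ_N there exist k ∈ {1,…,N} and ω, ω′ ∈ Λ_k such that ξ ∈ Σ_{N,k}^ω, ξ′ ∈ Σ_{N,k}^{ω′}, and either (i) k < N and 2^{2-k} ≤ |ω − ω′| ≤ 2^{4-k}, or (ii) k = N and |ω − ω′| ≤ 2^{4-N}; that is, Σ_N × Σ_N is covered by products of related (N,k)-sectors with centers in Λ_k. -/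
noncomputable section

/-- The frustum `Σ_N = {ξ : 2^N ≤ |ξ| ≤ 2^{N+1}}` for `N ≥ 1`. -/
def frustum (d N : ℕ) : Set (EuclideanSpace ℝ (Fin d)) :=
  {ξ | (2 : ℝ) ^ N ≤ ‖ξ‖ ∧ ‖ξ‖ ≤ (2 : ℝ) ^ (N + 1)}

/-- The `(N,k)`-sector `Σ_{N,k}^ω = {ξ ∈ Σ_N : |ξ/|ξ| − ω| ≤ 2^{-k}}`. -/
def sector (d N k : ℕ) (ω : EuclideanSpace ℝ (Fin d)) : Set (EuclideanSpace ℝ (Fin d)) :=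
  {ξ | ξ ∈ frustum d N ∧ ‖‖ξ‖⁻¹ • ξ - ω‖ ≤ (2 : ℝ) ^ (-(k : ℤ))}

theorem exists_whitney_scale (D : ℝ) (hD : D ≤ 2) (N : ℕ) (hN : 1 ≤ N) :
    ∃ k, 1 ≤ k ∧ k ≤ N ∧ D * 2 ^ k ≤ 14 ∧ (k = N ∨ (k < N ∧ 6 ≤ D * 2 ^ k)) := by
  induction N, hN using Nat.le_induction with
  | base => exact ⟨1, le_rfl, le_rfl, by linarith, Or.inl rfl⟩
  | succ n hn ih =>
    obtain ⟨k, h1, h2, h3, h4⟩ := ih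
    by_cases h6 : 6 ≤ D * 2 ^ k
    · exact ⟨k, h1, by omega, h3, Or.inr ⟨by omega, h6⟩⟩
    · have hk : k = n := by
        rcases h4 with h | h
        · exact h
        · exact absurd h.2 h6
      subst hk
      refine ⟨k + 1, by omega, le_rfl, ?_, Or.inl rfl⟩
      rw [pow_succ]
      linarith

/-- **Whitney decomposition of `Σ_N × Σ_N` into products of related sectors.**
Given, for each `1 ≤ k ≤ N`, a `2^{-k}`-net `Λ_k` in the unit sphere, every pair of
points of `Σ_N` lies in a product of related `(N,k)`-sectors with centers in `Λ_k`. -/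
theorem whitney_decomposition_of_frustum_square
    (d N : ℕ) (hd : 2 ≤ d) (hN : 1 ≤ N)
    (Λ : ℕ → Set (EuclideanSpace ℝ (Fin d)))
    (hΛ_sphere : ∀ k, 1 ≤ k → k ≤ N → ∀ ω ∈ Λ k, ‖ω‖ = 1)
    (hΛ_net : ∀ k, 1 ≤ k → k ≤ N → ∀ v : EuclideanSpace ℝ (Fin d), ‖v‖ = 1 →
      ∃ ω ∈ Λ k, ‖v - ω‖ ≤ (2 : ℝ) ^ (-(k : ℤ))) :
    ∀ ξ ∈ frustum d N, ∀ ξ' ∈ frustum d N,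
      ∃ k, 1 ≤ k ∧ k ≤ N ∧ ∃ ω ∈ Λ k, ∃ ω' ∈ Λ k,
        ξ ∈ sector d N k ω ∧ ξ' ∈ sector d N k ω' ∧
        ((k < N ∧ (2 : ℝ) ^ ((2 : ℤ) - k) ≤ ‖ω - ω'‖ ∧
            ‖ω - ω'‖ ≤ (2 : ℝ) ^ ((4 : ℤ) - k)) ∨
          (k = N ∧ ‖ω - ω'‖ ≤ (2 : ℝ) ^ ((4 : ℤ) - (N : ℤ)))) := by
  intro ξ hξ ξ' hξ'
  have unit : ∀ x ∈ frustum d N, ‖‖x‖⁻¹ • x‖ = 1 := by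
    intro x hx
    have h0 : 0 < ‖x‖ := lt_of_lt_of_le (by positivity) hx.1
    rw [norm_smul, norm_inv, norm_norm, inv_mul_cancel₀ h0.ne']
  have hv := unit ξ hξ
  have hv' := unit ξ' hξ'
  set v := ‖ξ‖⁻¹ • ξ with hvdef
  set v' := ‖ξ'‖⁻¹ • ξ' with hvdef'
  have hD : ‖v - v'‖ ≤ 2 := by
    have := norm_sub_le v v'
    linarith
  obtain ⟨k, h1, h2, h3, h4⟩ := exists_whitney_scale _ hD N hN
  obtain ⟨ω, hω, hn⟩ := hΛ_net k h1 h2 v hv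
  obtain ⟨ω', hω', hn'⟩ := hΛ_net k h1 h2 v' hv'
  refine ⟨k, h1, h2, ω, hω, ω', hω', ⟨hξ, hn⟩, ⟨hξ', hn'⟩, ?_⟩
  have e2 : (2 : ℝ) ^ ((2 : ℤ) - k) = 4 * (2 : ℝ) ^ (-(k : ℤ)) := by
    rw [sub_eq_add_neg, zpow_add₀ (by norm_num)]
    norm_num
  have e4 : (2 : ℝ) ^ ((4 : ℤ) - k) = 16 * (2 : ℝ) ^ (-(k : ℤ)) := by
    rw [sub_eq_add_neg, zpow_add₀ (by norm_num)]
    norm_num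
  have hp : (0 : ℝ) < (2 : ℝ) ^ (-(k : ℤ)) := by positivity
  have hpk : (2 : ℝ) ^ k * (2 : ℝ) ^ (-(k : ℤ)) = 1 := by
    rw [zpow_neg, zpow_natCast]
    exact mul_inv_cancel₀ (by positivity)
  generalize (2 : ℝ) ^ (-(k : ℤ)) = t at *
  have eD : ‖v - v'‖ * 2 ^ k * t = ‖v - v'‖ := by rw [mul_assoc, hpk, mul_one]
  have hup : ‖v - v'‖ ≤ 14 * t := by
    rw [← eD]
    exact mul_le_mul_of_nonneg_right h3 hp.le
  have ha : ‖ω - ω'‖ ≤ ‖v - v'‖ + 2 * t := by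
    have e : ω - ω' = (v - v') - (v - ω) + (v' - ω') := by abel
    have i1 := norm_add_le ((v - v') - (v - ω)) (v' - ω')
    have i2 := norm_sub_le (v - v') (v - ω)
    rw [← e] at i1
    linarith
  have hb : ‖v - v'‖ ≤ ‖ω - ω'‖ + 2 * t := by
    have e : v - v' = (ω - ω') + (v - ω) - (v' - ω') := by abel
    have i1 := norm_sub_le ((ω - ω') + (v - ω)) (v' - ω')
    have i2 := norm_add_le (ω - ω') (v - ω)
    rw [← e] at i1
    linarith
  rcases h4 with h | ⟨h, h6⟩
  · right
    refine ⟨h, ?_⟩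
    rw [← h, e4]
    linarith
  · left
    have hlo : 6 * t ≤ ‖v - v'‖ := by
      rw [← eD]
      exact mul_le_mul_of_nonneg_right h6 hp.le
    refine ⟨h, ?_, ?_⟩
    · rw [e2]
      linarith
    · rw [e4]
      linarith
end
end
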